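/- Let (a_{n,k}) be a lower triangular matrix with a_{n,k} ≥ 0 for k ≤ n, a_{n,k} = 0 for k > n, and ∑_{k=0}^n a_{n,k} = 1 for all n, such that for some β > 0 the sequences ((k+1)^{−β} a_{n,k})_{k=0}^n belong to HBVS with a constant independent of n, and (n+1)a_{n,n} = O(1). Let K_n(u) = ∑_{k=0}^n a_{n,k} · sin((k+1/2)u)/(2 sin(u/2)). Then ∫_0^π |K_n(u)| du = O(1); consequently, for every 2π-periodic g ∈ L^1[0,2π], ‖∑_{k=0}^n a_{n,k} S_k(g)‖_{L^1} ≤ C ‖g‖_{L^1} with C independent of n and g. -/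

import Mathlib

open MeasureTheory Finset Real

/-- The Dirichlet kernel `D_n(u) = 1/2 + ∑_{k=1}^n cos(k u)`. -/
noncomputable def dirichletKernel (n : ℕ) (u : ℝ) : ℝ :=
  1 / 2 + ∑ k ∈ Finset.Icc 1 n, Real.cos (k * u)

/-- The `n`-th partial sum of the Fourier series of a `2π`-periodic function `f`,
`S_n(f;x) = (1/π) ∫_0^{2π} f(t) D_n(x - t) dt`. -/
noncomputable def partialFourierSum (f : ℝ → ℝ) (n : ℕ) (x : ℝ) : ℝ :=
  (1 / Real.pi) * ∫ t in (0 : ℝ)..(2 * Real.pi), f t * dirichletKernel n (x - t)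

/-- The normalized `L^p` norm `‖f‖_{L^p} = ((1/2π) ∫_0^{2π} |f(x)|^p dx)^{1/p}`. -/
noncomputable def lpNorm (p : ℝ) (f : ℝ → ℝ) : ℝ :=
  ((1 / (2 * Real.pi)) * ∫ x in (0 : ℝ)..(2 * Real.pi), |f x| ^ p) ^ (1 / p)

/-- The integral modulus of continuity
`ω_p(f;δ) = sup_{0<|h|≤δ} ((1/2π) ∫_0^{2π} |f(x+h) - f(x)|^p dx)^{1/p}`. -/
noncomputable def intModulus (p : ℝ) (f : ℝ → ℝ) (δ : ℝ) : ℝ :=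
  sSup {y : ℝ | ∃ h : ℝ, 0 < |h| ∧ |h| ≤ δ ∧
    y = ((1 / (2 * Real.pi)) * ∫ x in (0 : ℝ)..(2 * Real.pi), |f (x + h) - f x| ^ p) ^ (1 / p)}

/-- `f ∈ Lip(α,p)`: `f` is `2π`-periodic, belongs to `L^p[0,2π]`, and
`ω_p(f;δ) = O(δ^α)`. -/
def LipClass (α p : ℝ) (f : ℝ → ℝ) : Prop :=
  Function.Periodic f (2 * Real.pi) ∧
  IntervalIntegrable f MeasureTheory.volume 0 (2 * Real.pi) ∧
  IntervalIntegrable (fun x => |f x| ^ p) MeasureTheory.volume 0 (2 * Real.pi) ∧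
  ∃ C : ℝ, 0 < C ∧ ∀ δ : ℝ, 0 < δ → intModulus p f δ ≤ C * δ ^ α

/-- The matrix transform `T_n(f;x) = ∑_{k=0}^n a_{n,k} S_k(f;x)`. -/
noncomputable def matrixMeans (a : ℕ → ℕ → ℝ) (f : ℝ → ℝ) (n : ℕ) (x : ℝ) : ℝ :=
  ∑ k ∈ Finset.range (n + 1), a n k * partialFourierSum f k x

/-- `A_{n,m} = (1/(m+1)) ∑_{k=0}^m a_{n,k}`, the Cesàro mean of the `n`-th row. -/
noncomputable def rowMean (a : ℕ → ℕ → ℝ) (n m : ℕ) : ℝ :=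
  (1 / ((m : ℝ) + 1)) * ∑ k ∈ Finset.range (m + 1), a n k

/-- The Riesz means `R_n(f;x) = (1/P_n) ∑_{k=0}^n p_k S_k(f;x)` with weights `w`. -/
noncomputable def rieszMeans (w : ℕ → ℝ) (f : ℝ → ℝ) (n : ℕ) (x : ℝ) : ℝ :=
  (1 / (∑ k ∈ Finset.range (n + 1), w k)) *
    ∑ k ∈ Finset.range (n + 1), w k * partialFourierSum f k x

/-- The kernel `K_n(u) = ∑_{k=0}^n a_{n,k} sin((k+1/2)u)/(2 sin(u/2))`. -/
noncomputable def matrixKernel (a : ℕ → ℕ → ℝ) (n : ℕ) (u : ℝ) : ℝ :=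
  ∑ k ∈ Finset.range (n + 1),
    a n k * (Real.sin (((k : ℝ) + 1 / 2) * u) / (2 * Real.sin (u / 2)))

theorem continuous_dirichletKernel (n : ℕ) : Continuous (dirichletKernel n) := by
  unfold dirichletKernel
  fun_prop

theorem dirichletKernel_succ (n : ℕ) (u : ℝ) :
    dirichletKernel (n + 1) u = dirichletKernel n u + cos ((n + 1 : ℕ) * u) := by
  unfold dirichletKernel
  rw [Finset.sum_Icc_succ_top (by omega)]
  ring

theorem two_mul_sin_half_mul_dirichletKernel (n : ℕ) (u : ℝ) :
    2 * sin (u / 2) * dirichletKernel n u = sin (((n : ℝ) + 1 / 2) * u) := by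
  induction n with
  | zero =>
    simp only [dirichletKernel]
    norm_num
    ring_nf
  | succ n ih =>
    rw [dirichletKernel_succ, mul_add, ih]
    have h₁ : ((n : ℝ) + 1 / 2) * u = (n + 1 : ℕ) * u - u / 2 := by push_cast; ring
    have h₂ : (((n + 1 : ℕ) : ℝ) + 1 / 2) * u = (n + 1 : ℕ) * u + u / 2 := by ring
    rw [h₁, h₂, sin_sub, sin_add]
    ring

theorem four_mul_sin_half_sq_mul_sum_dirichletKernel (m : ℕ) (u : ℝ) :
    4 * sin (u / 2) ^ 2 * ∑ k ∈ range (m + 1), dirichletKernel k u = 1 - cos ((m + 1 : ℕ) * u) := by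
  have key : ∀ k : ℕ, 4 * sin (u / 2) ^ 2 * dirichletKernel k u
      = cos ((k : ℕ) * u) - cos ((k + 1 : ℕ) * u) := by
    intro k
    have h₁ : (k : ℝ) * u = ((k : ℝ) + 1 / 2) * u - u / 2 := by ring
    have h₂ : ((k + 1 : ℕ) : ℝ) * u = ((k : ℝ) + 1 / 2) * u + u / 2 := by push_cast; ring
    rw [h₁, h₂, cos_sub, cos_add, ← two_mul_sin_half_mul_dirichletKernel]
    ring
  rw [Finset.mul_sum, Finset.sum_congr rfl fun k _ => key k,
    Finset.sum_range_sub' (fun k : ℕ => cos ((k : ℝ) * u))]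
  simp

/-- The (unnormalized) Fejér kernel is nonnegative. -/
theorem sum_dirichletKernel_nonneg (m : ℕ) (u : ℝ) :
    0 ≤ ∑ k ∈ range (m + 1), dirichletKernel k u := by
  by_cases hs : sin (u / 2) = 0
  · obtain ⟨N, hN⟩ := sin_eq_zero_iff.mp hs
    refine Finset.sum_nonneg fun k _ => ?_
    have hcos : ∀ j : ℕ, cos (j * u) = 1 := by
      intro j
      have : (j : ℝ) * u = ((j * N : ℤ) : ℝ) * (2 * π) := by push_cast; linear_combination -2 * j * hN
      rw [this, cos_int_mul_two_pi]
    simp only [dirichletKernel, hcos]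
    positivity
  · have hpos : 0 < 4 * sin (u / 2) ^ 2 := by positivity
    refine nonneg_of_mul_nonneg_right (?_ : 0 ≤ 4 * sin (u / 2) ^ 2 * _) hpos
    rw [four_mul_sin_half_sq_mul_sum_dirichletKernel]
    linarith [cos_le_one (((m + 1 : ℕ) : ℝ) * u)]

theorem integral_dirichletKernel_zero_pi (n : ℕ) :
    ∫ u in (0 : ℝ)..π, dirichletKernel n u = π / 2 := by
  induction n with
  | zero => simp [dirichletKernel]; ring
  | succ n ih =>
    simp only [dirichletKernel_succ]
    rw [intervalIntegral.integral_add ((continuous_dirichletKernel n).intervalIntegrable _ _)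
      (Continuous.intervalIntegrable (by fun_prop) _ _), ih,
      intervalIntegral.integral_comp_mul_left cos (c := ((n + 1 : ℕ) : ℝ)) (by positivity),
      integral_cos, sin_nat_mul_pi]
    simp

/-- Summation by parts against an arbitrary sequence. -/
theorem sum_mul_eq_sum_sub_mul_sum (c d : ℕ → ℝ) (n : ℕ) :
    ∑ k ∈ range (n + 1), c k * d k = c n * ∑ j ∈ range (n + 1), d j
      + ∑ k ∈ range n, (c k - c (k + 1)) * ∑ j ∈ range (k + 1), d j := by
  induction n with
  | zero => simp
  | succ n ih =>
    rw [Finset.sum_range_succ, ih, Finset.sum_range_succ (fun k => (c k - c (k + 1)) * _) n,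
      Finset.sum_range_succ d (n + 1)]
    ring

/-- The nonnegative weights that dominate `∑ c k * d k` after summation by parts. -/
noncomputable def abelWeight (c : ℕ → ℝ) (n k : ℕ) : ℝ :=
  if k = n then |c n| else |c k - c (k + 1)|

theorem abelWeight_nonneg (c : ℕ → ℝ) (n k : ℕ) : 0 ≤ abelWeight c n k := by
  unfold abelWeight
  split_ifs <;> positivity

theorem sum_abelWeight_mul (c x : ℕ → ℝ) (n : ℕ) :
    ∑ k ∈ range (n + 1), abelWeight c n k * x k
      = |c n| * x n + ∑ k ∈ range n, |c k - c (k + 1)| * x k := by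
  rw [Finset.sum_range_succ, add_comm]
  congr 1
  · simp [abelWeight]
  · refine Finset.sum_congr rfl fun k hk => ?_
    rw [abelWeight, if_neg (Finset.mem_range.mp hk).ne]

theorem abs_sum_mul_dirichletKernel_le (c : ℕ → ℝ) (n : ℕ) (u : ℝ) :
    |∑ k ∈ range (n + 1), c k * dirichletKernel k u|
      ≤ ∑ k ∈ range (n + 1), abelWeight c n k * ∑ j ∈ range (k + 1), dirichletKernel j u := by
  rw [sum_mul_eq_sum_sub_mul_sum, sum_abelWeight_mul]
  refine (abs_add_le _ _).trans (add_le_add ?_ ((Finset.abs_sum_le_sum_abs _ _).trans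
    (Finset.sum_le_sum fun k _ => ?_)))
  · rw [abs_mul, abs_of_nonneg (sum_dirichletKernel_nonneg n u)]
  · rw [abs_mul, abs_of_nonneg (sum_dirichletKernel_nonneg k u)]

theorem matrixKernel_eq (a : ℕ → ℕ → ℝ) (n : ℕ) {u : ℝ} (hu : sin (u / 2) ≠ 0) :
    matrixKernel a n u = ∑ k ∈ range (n + 1), a n k * dirichletKernel k u := by
  refine Finset.sum_congr rfl fun k _ => ?_
  rw [← two_mul_sin_half_mul_dirichletKernel]
  field_simp

theorem integral_abs_sum_mul_dirichletKernel_le (c : ℕ → ℝ) (n : ℕ) :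
    ∫ u in (0 : ℝ)..π, |∑ k ∈ range (n + 1), c k * dirichletKernel k u|
      ≤ (∑ k ∈ range (n + 1), abelWeight c n k * (k + 1)) * (π / 2) := by
  have hD := continuous_dirichletKernel
  calc _ ≤ ∫ u in (0 : ℝ)..π, ∑ k ∈ range (n + 1),
          abelWeight c n k * ∑ j ∈ range (k + 1), dirichletKernel j u :=
        intervalIntegral.integral_mono_on pi_pos.le
          (Continuous.intervalIntegrable (by fun_prop) _ _)
          (Continuous.intervalIntegrable (by fun_prop) _ _)
          fun u _ => abs_sum_mul_dirichletKernel_le c n u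
    _ = _ := by
        rw [intervalIntegral.integral_finsetSum
          fun k _ => Continuous.intervalIntegrable (by fun_prop) _ _, Finset.sum_mul]
        refine Finset.sum_congr rfl fun k _ => ?_
        rw [intervalIntegral.integral_const_mul, intervalIntegral.integral_finsetSum
          fun j _ => (hD j).intervalIntegrable _ _]
        simp [integral_dirichletKernel_zero_pi]
        ring

section Convolution

variable {g : ℝ → ℝ}

theorem intervalIntegrable_mul_dirichletKernel
    (hg : IntervalIntegrable g volume 0 (2 * π)) (n : ℕ) (x : ℝ) :
    IntervalIntegrable (fun t => g t * dirichletKernel n (x - t)) volume 0 (2 * π) := by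
  have hD := continuous_dirichletKernel n
  exact hg.mul_continuousOn (by fun_prop)

theorem integral_mul_cos_sub (hg : IntervalIntegrable g volume 0 (2 * π)) (c x : ℝ) :
    ∫ t in (0 : ℝ)..(2 * π), g t * cos (c * (x - t))
      = cos (c * x) * (∫ t in (0 : ℝ)..(2 * π), g t * cos (c * t))
        + sin (c * x) * ∫ t in (0 : ℝ)..(2 * π), g t * sin (c * t) := by
  rw [← intervalIntegral.integral_const_mul, ← intervalIntegral.integral_const_mul,
    ← intervalIntegral.integral_add]
  · refine intervalIntegral.integral_congr fun t _ => ?_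
    simp only [mul_sub, cos_sub]
    ring
  · exact (hg.mul_continuousOn (by fun_prop)).const_mul _
  · exact (hg.mul_continuousOn (by fun_prop)).const_mul _

theorem integral_mul_dirichletKernel_succ (hg : IntervalIntegrable g volume 0 (2 * π))
    (n : ℕ) (x : ℝ) :
    ∫ t in (0 : ℝ)..(2 * π), g t * dirichletKernel (n + 1) (x - t)
      = (∫ t in (0 : ℝ)..(2 * π), g t * dirichletKernel n (x - t))
        + ∫ t in (0 : ℝ)..(2 * π), g t * cos ((n + 1 : ℕ) * (x - t)) := by
  rw [← intervalIntegral.integral_add (intervalIntegrable_mul_dirichletKernel hg n x)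
    (hg.mul_continuousOn (by fun_prop))]
  simp only [dirichletKernel_succ, mul_add]

theorem continuous_integral_mul_dirichletKernel (hg : IntervalIntegrable g volume 0 (2 * π))
    (n : ℕ) : Continuous fun x => ∫ t in (0 : ℝ)..(2 * π), g t * dirichletKernel n (x - t) := by
  induction n with
  | zero => simp only [dirichletKernel]; simpa using continuous_const
  | succ n ih =>
    simp only [integral_mul_dirichletKernel_succ hg, integral_mul_cos_sub hg]
    fun_prop

theorem integral_integral_mul_dirichletKernel (hg : IntervalIntegrable g volume 0 (2 * π))
    (n : ℕ) :
    ∫ x in (0 : ℝ)..(2 * π), ∫ t in (0 : ℝ)..(2 * π), g t * dirichletKernel n (x - t)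
      = π * ∫ t in (0 : ℝ)..(2 * π), g t := by
  induction n with
  | zero =>
    simp [dirichletKernel]
    ring
  | succ n ih =>
    have hn : ((n + 1 : ℕ) : ℝ) ≠ 0 := by positivity
    simp only [integral_mul_dirichletKernel_succ hg, integral_mul_cos_sub hg]
    rw [intervalIntegral.integral_add
      ((continuous_integral_mul_dirichletKernel hg n).intervalIntegrable _ _)
      (Continuous.intervalIntegrable (by fun_prop) _ _), ih,
      intervalIntegral.integral_add (Continuous.intervalIntegrable (by fun_prop) _ _)
      (Continuous.intervalIntegrable (by fun_prop) _ _),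
      intervalIntegral.integral_mul_const, intervalIntegral.integral_mul_const,
      intervalIntegral.integral_comp_mul_left cos hn,
      intervalIntegral.integral_comp_mul_left sin hn, integral_cos, integral_sin,
      cos_nat_mul_two_pi]
    have hsin : sin (((n + 1 : ℕ) : ℝ) * (2 * π)) = 0 := by
      rw [show ((n + 1 : ℕ) : ℝ) * (2 * π) = ((2 * (n + 1) : ℕ) : ℝ) * π by push_cast; ring,
        sin_nat_mul_pi]
    rw [hsin]
    simp

theorem abs_matrixMeans_le (a : ℕ → ℕ → ℝ) (hg : IntervalIntegrable g volume 0 (2 * π))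
    (n : ℕ) (x : ℝ) :
    |matrixMeans a g n x| ≤ (1 / π) * ∑ k ∈ range (n + 1), abelWeight (a n) n k *
      ∑ j ∈ range (k + 1), ∫ t in (0 : ℝ)..(2 * π), |g t| * dirichletKernel j (x - t) := by
  have hI := fun k => intervalIntegrable_mul_dirichletKernel hg k x
  have hI' := fun k => intervalIntegrable_mul_dirichletKernel hg.abs k x
  have hrepr : matrixMeans a g n x = (1 / π) * ∫ t in (0 : ℝ)..(2 * π),
      g t * ∑ k ∈ range (n + 1), a n k * dirichletKernel k (x - t) := by
    have hsum : ∀ t, g t * ∑ k ∈ range (n + 1), a n k * dirichletKernel k (x - t)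
        = ∑ k ∈ range (n + 1), a n k * (g t * dirichletKernel k (x - t)) := fun t => by
      rw [Finset.mul_sum]
      exact Finset.sum_congr rfl fun k _ => by ring
    simp only [hsum]
    rw [intervalIntegral.integral_finsetSum fun k _ => (hI k).const_mul _, Finset.mul_sum]
    refine Finset.sum_congr rfl fun k _ => ?_
    rw [intervalIntegral.integral_const_mul, partialFourierSum]
    ring
  have hmajor : ∑ k ∈ range (n + 1), abelWeight (a n) n k *
      ∑ j ∈ range (k + 1), ∫ t in (0 : ℝ)..(2 * π), |g t| * dirichletKernel j (x - t)
      = ∫ t in (0 : ℝ)..(2 * π), |g t| * ∑ k ∈ range (n + 1), abelWeight (a n) n k *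
        ∑ j ∈ range (k + 1), dirichletKernel j (x - t) := by
    have hsum : ∀ t, |g t| * ∑ k ∈ range (n + 1), abelWeight (a n) n k *
        ∑ j ∈ range (k + 1), dirichletKernel j (x - t)
        = ∑ k ∈ range (n + 1), ∑ j ∈ range (k + 1),
          abelWeight (a n) n k * (|g t| * dirichletKernel j (x - t)) := fun t => by
      simp only [Finset.mul_sum]
      exact Finset.sum_congr rfl fun k _ => Finset.sum_congr rfl fun j _ => by ring
    simp only [hsum]
    rw [intervalIntegral.integral_finsetSum fun k _ => by
      simpa only [Finset.sum_fn] using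
        IntervalIntegrable.sum (range (k + 1)) fun j _ => (hI' j).const_mul (abelWeight (a n) n k)]
    refine Finset.sum_congr rfl fun k _ => ?_
    rw [intervalIntegral.integral_finsetSum fun j _ => (hI' j).const_mul _, Finset.mul_sum]
    simp only [intervalIntegral.integral_const_mul]
  have hD := continuous_dirichletKernel
  rw [hrepr, abs_mul, abs_of_pos (by positivity : 0 < 1 / π), hmajor]
  gcongr
  refine (intervalIntegral.abs_integral_le_integral_abs (by positivity)).trans
    (intervalIntegral.integral_mono_on (by positivity)
      (hg.mul_continuousOn (by fun_prop)).abs (hg.abs.mul_continuousOn (by fun_prop))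
      fun t _ => ?_)
  rw [abs_mul]
  gcongr
  exact abs_sum_mul_dirichletKernel_le _ _ _

theorem integral_abs_matrixMeans_le (a : ℕ → ℕ → ℝ) (hg : IntervalIntegrable g volume 0 (2 * π))
    (n : ℕ) :
    ∫ x in (0 : ℝ)..(2 * π), |matrixMeans a g n x|
      ≤ (∑ k ∈ range (n + 1), abelWeight (a n) n k * (k + 1))
        * ∫ t in (0 : ℝ)..(2 * π), |g t| := by
  have hG := continuous_integral_mul_dirichletKernel hg
  have hG' := continuous_integral_mul_dirichletKernel hg.abs
  have hT : Continuous (matrixMeans a g n) := by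
    unfold matrixMeans partialFourierSum
    fun_prop
  refine (intervalIntegral.integral_mono_on (by positivity) (hT.abs.intervalIntegrable _ _)
    (Continuous.intervalIntegrable (by fun_prop) _ _)
    fun x _ => abs_matrixMeans_le a hg n x).trans_eq ?_
  rw [intervalIntegral.integral_const_mul, intervalIntegral.integral_finsetSum
    fun k _ => Continuous.intervalIntegrable (by fun_prop) _ _, Finset.mul_sum, Finset.sum_mul]
  refine Finset.sum_congr rfl fun k _ => ?_
  rw [intervalIntegral.integral_const_mul, intervalIntegral.integral_finsetSum
    fun j _ => (hG' j).intervalIntegrable _ _]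
  simp only [integral_integral_mul_dirichletKernel hg.abs]
  simp
  field_simp

end Convolution

theorem lpNorm_one (f : ℝ → ℝ) :
    _root_.lpNorm 1 f = 1 / (2 * π) * ∫ x in (0 : ℝ)..(2 * π), |f x| := by
  simp [_root_.lpNorm]

/-- If `(k+1)^{-β} a_k` has head bounded variation, then so does `a_k`. -/
theorem sum_abs_sub_le_of_headBoundedVariation {a : ℕ → ℝ} {n : ℕ} {β K : ℝ}
    (hpos : ∀ k ≤ n, 0 ≤ a k) (hβ : 0 ≤ β) (hK : 0 ≤ K)
    (h : ∀ m ≤ n, ∑ k ∈ range m,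
      |((k : ℝ) + 1) ^ (-β) * a k - ((k : ℝ) + 2) ^ (-β) * a (k + 1)|
        ≤ K * (((m : ℝ) + 1) ^ (-β) * a m)) :
    ∑ k ∈ range n, |a k - a (k + 1)| ≤ (2 * K + 1) * a n := by
  set c : ℕ → ℝ := fun k => ((k : ℝ) + 1) ^ (-β) * a k with hc
  have hcs : ∀ k : ℕ, c (k + 1) = ((k : ℝ) + 2) ^ (-β) * a (k + 1) := fun k => by
    simp only [hc]; push_cast; ring_nf
  have hac : ∀ k : ℕ, a k = ((k : ℝ) + 1) ^ β * c k := fun k => by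
    have hk : (0 : ℝ) < k + 1 := by positivity
    simp only [hc]
    rw [← mul_assoc, ← rpow_add hk, add_neg_cancel, rpow_zero, one_mul]
  have hTV : ∑ k ∈ range n, |c k - c (k + 1)| ≤ K * c n := by
    simpa only [hcs] using h n le_rfl
  have hcn : ∀ k ∈ range n, c k ≤ (K + 1) * c n := by
    intro k hk
    have hkn := Finset.mem_range.mp hk
    have htel : c k - c n = ∑ j ∈ Finset.Ico k n, (c j - c (j + 1)) := by
      rw [Finset.sum_Ico_eq_sub _ hkn.le, Finset.sum_range_sub', Finset.sum_range_sub']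
      ring
    have hle : c k - c n ≤ ∑ j ∈ range n, |c j - c (j + 1)| := by
      rw [htel]
      refine (Finset.sum_le_sum fun j _ => le_abs_self _).trans
        (Finset.sum_le_sum_of_subset_of_nonneg ?_ fun _ _ _ => abs_nonneg _)
      intro j hj
      simp only [Finset.mem_Ico] at hj
      exact Finset.mem_range.mpr hj.2
    linarith
  have hc0 : 0 ≤ c n := mul_nonneg (by positivity) (hpos n le_rfl)
  have hterm : ∀ k ∈ range n, |a k - a (k + 1)| ≤ ((n : ℝ) + 1) ^ β * |c k - c (k + 1)|
      + ((((k + 1 : ℕ) : ℝ) + 1) ^ β - ((k : ℝ) + 1) ^ β) * ((K + 1) * c n) := by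
    intro k hk
    have hkn := Finset.mem_range.mp hk
    have hmono : ((k : ℝ) + 1) ^ β ≤ (((k + 1 : ℕ) : ℝ) + 1) ^ β :=
      rpow_le_rpow (by positivity) (by push_cast; linarith) hβ
    have htop : (((k + 1 : ℕ) : ℝ) + 1) ^ β ≤ ((n : ℝ) + 1) ^ β :=
      rpow_le_rpow (by positivity) (by gcongr; omega) hβ
    have hck : 0 ≤ c k := mul_nonneg (by positivity) (hpos k hkn.le)
    have hsplit : a k - a (k + 1) = (((k + 1 : ℕ) : ℝ) + 1) ^ β * (c k - c (k + 1))
        - ((((k + 1 : ℕ) : ℝ) + 1) ^ β - ((k : ℝ) + 1) ^ β) * c k := by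
      rw [hac k, hac (k + 1)]
      ring
    rw [hsplit]
    refine (abs_sub _ _).trans (add_le_add ?_ ?_)
    · rw [abs_mul, abs_of_nonneg (by positivity)]
      gcongr
    · rw [abs_mul, abs_of_nonneg (sub_nonneg.mpr hmono), abs_of_nonneg hck]
      exact mul_le_mul_of_nonneg_left (hcn k hk) (sub_nonneg.mpr hmono)
  refine (Finset.sum_le_sum hterm).trans ?_
  rw [Finset.sum_add_distrib, ← Finset.mul_sum, ← Finset.sum_mul,
    Finset.sum_range_sub (fun k : ℕ => ((k : ℝ) + 1) ^ β), hac n]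
  have hn : (0 : ℝ) ≤ ((n : ℝ) + 1) ^ β := by positivity
  have h₁ := mul_le_mul_of_nonneg_left hTV hn
  have h₂ : 0 ≤ (K + 1) * c n := by positivity
  have h₃ : (0 : ℝ) ≤ (((0 : ℕ) : ℝ) + 1) ^ β := by positivity
  nlinarith [mul_nonneg h₃ h₂]

theorem sum_abelWeight_mul_le {a : ℕ → ℝ} {n : ℕ} {V : ℝ} (ha : 0 ≤ a n)
    (hV : ∑ k ∈ range n, |a k - a (k + 1)| ≤ V * a n) :
    ∑ k ∈ range (n + 1), abelWeight a n k * ((k : ℝ) + 1) ≤ (V + 1) * ((n + 1) * a n) := by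
  rw [sum_abelWeight_mul a (fun k => (k : ℝ) + 1), abs_of_nonneg ha]
  have h : ∑ k ∈ range n, |a k - a (k + 1)| * ((k : ℝ) + 1)
      ≤ (∑ k ∈ range n, |a k - a (k + 1)|) * ((n : ℝ) + 1) := by
    rw [Finset.sum_mul]
    refine Finset.sum_le_sum fun k hk => ?_
    have := (Finset.mem_range.mp hk).le
    gcongr
  have h' := mul_le_mul_of_nonneg_right hV (by positivity : (0 : ℝ) ≤ (n : ℝ) + 1)
  linarith

/-- under the hypotheses of Theorem 5 (vi) on the matrix (nonnegative,
lower triangular, row sums `1`, `((k+1)^{-β} a_{n,k}) ∈ HBVS` uniformly in `n` for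
some `β > 0`, and `(n+1)a_{n,n} = O(1)`), the kernel
`K_n(u) = ∑_{k=0}^n a_{n,k} sin((k+1/2)u)/(2 sin(u/2))` satisfies
`∫_0^π |K_n(u)| du = O(1)`; consequently, for every `2π`-periodic `g ∈ L^1[0,2π]`,
`‖∑_{k=0}^n a_{n,k} S_k(g)‖_{L^1} ≤ C ‖g‖_{L^1}` with `C` independent of `n` and `g`. -/
theorem kernel_L1_bound (a : ℕ → ℕ → ℝ)
    (hpos : ∀ n k, k ≤ n → 0 ≤ a n k)
    (hzero : ∀ n k, n < k → a n k = 0)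
    (hsum : ∀ n, ∑ k ∈ Finset.range (n + 1), a n k = 1)
    (β : ℝ) (hβ : 0 < β)
    (hHBVS : ∃ K : ℝ, ∀ n m : ℕ, m ≤ n →
      ∑ k ∈ Finset.range m,
        |((k : ℝ) + 1) ^ (-β) * a n k - ((k : ℝ) + 2) ^ (-β) * a n (k + 1)| ≤
          K * (((m : ℝ) + 1) ^ (-β) * a n m))
    (hO : ∃ C : ℝ, ∀ n : ℕ, ((n : ℝ) + 1) * a n n ≤ C) :
    ∃ C : ℝ,
      (∀ n : ℕ, (∫ u in (0 : ℝ)..Real.pi, |matrixKernel a n u|) ≤ C) ∧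
      (∀ (n : ℕ) (g : ℝ → ℝ), Function.Periodic g (2 * Real.pi) →
        IntervalIntegrable g MeasureTheory.volume 0 (2 * Real.pi) →
        lpNorm 1 (fun x => matrixMeans a g n x) ≤ C * lpNorm 1 g) := by
  obtain ⟨K, hK⟩ := hHBVS
  obtain ⟨B, hB⟩ := hO
  set M : ℝ := (2 * |K| + 1 + 1) * B with hM
  have hw : ∀ n, ∑ k ∈ range (n + 1), abelWeight (a n) n k * ((k : ℝ) + 1) ≤ M := by
    intro n
    have hvar := sum_abs_sub_le_of_headBoundedVariation (a := a n) (n := n) (K := |K|)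
      (hpos n) hβ.le (abs_nonneg K) fun m hm => (hK n m hm).trans
        (mul_le_mul_of_nonneg_right (le_abs_self K)
          (mul_nonneg (by positivity) (hpos n m hm)))
    refine (sum_abelWeight_mul_le (hpos n n le_rfl) hvar).trans ?_
    rw [hM]
    gcongr
    exact hB n
  have hM0 : 0 ≤ M := (Finset.sum_nonneg fun k _ =>
    mul_nonneg (abelWeight_nonneg _ _ _) (by positivity)).trans (hw 0)
  refine ⟨2 * M, fun n => ?_, fun n g _ hg => ?_⟩
  · have hcongr : ∫ u in (0 : ℝ)..π, |matrixKernel a n u|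
        = ∫ u in (0 : ℝ)..π, |∑ k ∈ range (n + 1), a n k * dirichletKernel k u| := by
      refine intervalIntegral.integral_congr_ae (Filter.Eventually.of_forall fun u hu => ?_)
      rw [Set.uIoc_of_le pi_pos.le] at hu
      rw [matrixKernel_eq a n (sin_pos_of_pos_of_lt_pi (by linarith [hu.1])
        (by linarith [hu.1, hu.2])).ne']
    rw [hcongr]
    refine (integral_abs_sum_mul_dirichletKernel_le (a n) n).trans ?_
    have := mul_le_mul_of_nonneg_right (hw n) (by positivity : 0 ≤ π / 2)
    nlinarith [pi_le_four]
  · rw [lpNorm_one, lpNorm_one, mul_left_comm]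
    gcongr
    have hg0 : 0 ≤ ∫ t in (0 : ℝ)..(2 * π), |g t| :=
      intervalIntegral.integral_nonneg (by positivity) fun _ _ => abs_nonneg _
    refine (integral_abs_matrixMeans_le a hg n).trans (mul_le_mul_of_nonneg_right ?_ hg0)
    linarith [hw n]
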